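/- Darmois–Skitovich theorem (special case used for LiNGAM asymmetry): if X and E are independent real random variables and the two linear combinations L₁ = aX + bE and L₂ = cX + dE are independent, with a·c ≠ 0 and b·d ≠ 0, then X and E are both Gaussian. -/

import Mathlib

open MeasureTheory ProbabilityTheory
open scoped NNReal

/-- Two continuous functions on a simply connected space with the same exponential are equal as
soon as they agree at one point. -/
lemma eq_of_exp_comp_eq {A : Type*} [TopologicalSpace A] [SimplyConnectedSpace A]
    [LocallyPathConnectedSpace A] {F G : A → ℂ} (hF : Continuous F) (hG : Continuous G) {a : A}
    (ha : F a = G a) (h : ∀ x, Complex.exp (F x) = Complex.exp (G x)) (x : A) : F x = G x := by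
  have key := Complex.isCoveringMapOn_exp.existsUnique_continuousMap_lifts
    (⟨fun x ↦ Complex.exp (G x), by fun_prop⟩ : C(A, ℂ)) (a₀ := a) (e₀ := G a) rfl
    (fun x ↦ by simp)
  have hu := key.unique (y₁ := ⟨F, hF⟩) (y₂ := ⟨G, hG⟩) ⟨ha, funext h⟩ ⟨rfl, rfl⟩
  exact DFunLike.congr_fun hu x

/-- A nowhere vanishing continuous function on the real line with value `1` at `0` has a continuous
logarithm vanishing at `0`. -/
lemma exists_continuous_log {f : ℝ → ℂ} (hf : Continuous f) (h0 : f 0 = 1) (hne : ∀ x, f x ≠ 0) :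
    ∃ φ : ℝ → ℂ, Continuous φ ∧ φ 0 = 0 ∧ ∀ x, Complex.exp (φ x) = f x := by
  obtain ⟨φ, ⟨h1, h2⟩, -⟩ := Complex.isCoveringMapOn_exp.existsUnique_continuousMap_lifts
    (⟨f, hf⟩ : C(ℝ, ℂ)) (a₀ := 0) (e₀ := 0) (by simp [h0]) (fun x ↦ by simpa using hne x)
  exact ⟨φ, φ.continuous, h1, fun x ↦ congrFun h2 x⟩

lemma eq_mul_of_continuous_of_add {ψ : ℝ → ℂ} (hψ : Continuous ψ)
    (hadd : ∀ x y, ψ (x + y) = ψ x + ψ y) (x : ℝ) : ψ x = x * ψ 1 := by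
  have h : ψ (x • 1) = x • ψ 1 := ((AddMonoidHom.mk' ψ hadd).toRealLinearMap hψ).map_smul x 1
  simpa using h

/-- A continuous function whose third differences at the origin vanish is a quadratic polynomial. -/
lemma eq_quadratic_of_third_difference_eq_zero {φ : ℝ → ℂ} (hφ : Continuous φ)
    (h : ∀ x y z, φ (x + y + z) + φ x + φ y + φ z = φ (x + y) + φ (y + z) + φ (x + z)) :
    ∃ m q : ℂ, ∀ x : ℝ, φ x = m * x + q * x ^ 2 := by
  have h₁ (x y : ℝ) : φ (x + y) - φ x - φ y = x * (φ (1 + y) - φ 1 - φ y) := by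
    refine eq_mul_of_continuous_of_add (ψ := fun x ↦ φ (x + y) - φ x - φ y) (by fun_prop)
      (fun u v ↦ ?_) x
    linear_combination h u v y
  have h₂ (y : ℝ) : φ (1 + y) - φ 1 - φ y = y * (φ (1 + 1) - φ 1 - φ 1) := by
    rw [add_comm 1 y, sub_right_comm, h₁]
  have h₃ (x : ℝ) : φ x - (φ (1 + 1) - φ 1 - φ 1) / 2 * x ^ 2
      = x * (φ 1 - (φ (1 + 1) - φ 1 - φ 1) / 2) := by
    have := eq_mul_of_continuous_of_add
      (ψ := fun x : ℝ ↦ φ x - (φ (1 + 1) - φ 1 - φ 1) / 2 * x ^ 2) (by fun_prop)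
      (fun u v ↦ by
        have := h₁ u v
        rw [h₂] at this
        push_cast
        linear_combination this) x
    simpa using this
  exact ⟨φ 1 - (φ (1 + 1) - φ 1 - φ 1) / 2, (φ (1 + 1) - φ 1 - φ 1) / 2,
    fun x ↦ by linear_combination h₃ x⟩

/-- A probability measure on the real line is Gaussian if its characteristic function vanishes
nowhere and has trivial multiplicative third differences at the origin. -/
lemma exists_eq_gaussianReal_of_charFun {ν : Measure ℝ} [IsProbabilityMeasure ν]
    (hne : ∀ x, charFun ν x ≠ 0)
    (h : ∀ x y z, charFun ν (x + y + z) * charFun ν x * charFun ν y * charFun ν z =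
      charFun ν (x + y) * charFun ν (y + z) * charFun ν (x + z)) :
    ∃ (m : ℝ) (v : ℝ≥0), ν = gaussianReal m v := by
  obtain ⟨φ, hφ, h0, hexp⟩ := exists_continuous_log continuous_charFun (by simp) hne
  have hdiff (p : ℝ × ℝ × ℝ) :
      φ (p.1 + p.2.1 + p.2.2) + φ p.1 + φ p.2.1 + φ p.2.2
        = φ (p.1 + p.2.1) + φ (p.2.1 + p.2.2) + φ (p.1 + p.2.2) := by
    refine eq_of_exp_comp_eq
      (F := fun p : ℝ × ℝ × ℝ ↦ φ (p.1 + p.2.1 + p.2.2) + φ p.1 + φ p.2.1 + φ p.2.2)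
      (G := fun p : ℝ × ℝ × ℝ ↦ φ (p.1 + p.2.1) + φ (p.2.1 + p.2.2) + φ (p.1 + p.2.2))
      (by fun_prop) (by fun_prop) (a := 0) (by simp [h0]) (fun p ↦ ?_) p
    simp only [Complex.exp_add, hexp]
    exact h p.1 p.2.1 p.2.2
  obtain ⟨m, q, hmq⟩ :=
    eq_quadratic_of_third_difference_eq_zero hφ fun x y z ↦ hdiff (x, y, z)
  have hconj (x : ℝ) : φ (-x) = (starRingEnd ℂ) (φ x) := by
    refine eq_of_exp_comp_eq (F := fun x ↦ φ (-x)) (G := fun x ↦ (starRingEnd ℂ) (φ x))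
      (by fun_prop) (Complex.continuous_conj.comp hφ) (a := 0) (by simp [h0]) (fun x ↦ ?_) x
    rw [Complex.exp_conj, hexp, hexp, charFun_neg]
  have hre (x : ℝ) : m.re * x + q.re * x ^ 2 ≤ 0 := by
    have h1 := norm_charFun_le_one (μ := ν) x
    rw [← hexp, Complex.norm_exp, Real.exp_le_one_iff, hmq] at h1
    simpa [← Complex.ofReal_pow] using h1
  have him : q.im = 0 := by
    have h1 := congrArg Complex.im (hconj 1)
    have h2 := congrArg Complex.im (hconj (-1))
    simp [hmq] at h1 h2
    linarith
  have hmre : m.re = 0 := by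
    have h1 := congrArg Complex.re (hconj 1)
    simp [hmq] at h1
    linarith
  have hq : 0 ≤ -2 * q.re := by
    have := hre 1
    simp [hmre] at this
    linarith
  refine ⟨m.im, (-2 * q.re).toNNReal, Measure.ext_of_charFun (funext fun x ↦ ?_)⟩
  rw [charFun_gaussianReal, Real.coe_toNNReal _ hq, ← hexp, hmq]
  congr 1
  apply Complex.ext <;> simp [← Complex.ofReal_pow, him, hmre] <;> ring

/-- A probability measure on the real line whose characteristic function has modulus one
everywhere is Gaussian (in fact a Dirac mass). -/
lemma exists_eq_gaussianReal_of_norm_charFun_eq_one {ν : Measure ℝ} [IsProbabilityMeasure ν]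
    (hν : ∀ x, ‖charFun ν x‖ = 1) : ∃ (m : ℝ) (v : ℝ≥0), ν = gaussianReal m v := by
  have hae (t : ℝ) : ∀ᵐ x : ℝ ∂ν, Complex.exp (t * x * Complex.I) = charFun ν t := by
    rcases ae_eq_const_or_norm_integral_lt_of_norm_le_const (μ := ν) (C := 1)
      (f := fun x : ℝ ↦ Complex.exp (t * x * Complex.I))
      (.of_forall fun x ↦ by
        rw [← Complex.ofReal_mul, Complex.norm_exp_ofReal_mul_I]) with h | h
    · filter_upwards [h] with x hx
      rw [hx, charFun_apply_real, Function.const_apply, average_eq_integral]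
    · rw [← charFun_apply_real, hν] at h
      simp at h
  have hmul (s t : ℝ) : charFun ν (s + t) = charFun ν s * charFun ν t := by
    obtain ⟨x, h₁, h₂, h₃⟩ := ((hae s).and ((hae t).and (hae (s + t)))).exists
    rw [← h₁, ← h₂, ← h₃, ← Complex.exp_add]
    push_cast
    ring_nf
  refine exists_eq_gaussianReal_of_charFun (fun x hx ↦ by simpa [hx] using hν x) fun x y z ↦ ?_
  simp only [hmul]
  ring

/-- Solutions of the Darmois–Skitovich functional equation vanish nowhere. -/
lemma ne_zero_of_darmois_skitovich {f g : ℝ → ℂ} (hf : Continuous f) (hg : Continuous g)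
    (hf0 : f 0 ≠ 0) (hg0 : g 0 ≠ 0) {k l : ℝ} (hk : k ≠ 0) (hl : l ≠ 0)
    (h : ∀ x y, f (x + y) * g (k * x + l * y) = f x * g (k * x) * (f y * g (l * y))) :
    (∀ x, f x ≠ 0) ∧ ∀ x, g x ≠ 0 := by
  have hk' := abs_pos.2 hk
  have hl' := abs_pos.2 hl
  obtain ⟨m, hm, hkm, hlm, hms⟩ : ∃ m : ℝ, 0 < m ∧ |k| ≤ m ∧ |l| ≤ m ∧ m < |k| + |l| :=
    ⟨max |k| |l|, lt_max_of_lt_left hk', le_max_left _ _, le_max_right _ _,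
      max_lt (by linarith) (by linarith)⟩
  obtain ⟨q, hq0, hq1, hq2, hqs⟩ : ∃ q : ℝ, 0 ≤ q ∧ q < 1 ∧ 1 / 2 ≤ q ∧ m / (|k| + |l|) ≤ q :=
    ⟨max (1 / 2) (m / (|k| + |l|)), le_max_of_le_left (by norm_num),
      max_lt (by norm_num) ((div_lt_one (by positivity)).2 hms), le_max_left _ _, le_max_right _ _⟩
  have step (r : ℝ) (hr : ∀ u, |u| ≤ q * r → f u ≠ 0 ∧ g (m * u) ≠ 0) (u : ℝ) (hu : |u| ≤ r) :
      f u ≠ 0 ∧ g (m * u) ≠ 0 := by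
    have hscale (c : ℝ) (hc : |c| ≤ q) : |c * u| ≤ q * r := by
      rw [abs_mul]
      exact mul_le_mul hc hu (abs_nonneg _) hq0
    have hhalf (c : ℝ) (hc : |c| ≤ m) : |c / (2 * m)| ≤ q := by
      rw [abs_div, abs_of_pos (by positivity : 0 < 2 * m)]
      refine le_trans ?_ hq2
      rw [div_le_div_iff₀ (by positivity) (by positivity)]
      linarith
    have hpart (c : ℝ) (hc : |c| ≤ m) : |c / (|k| + |l|)| ≤ q := by
      rw [abs_div, abs_of_pos (by positivity : 0 < |k| + |l|)]
      exact le_trans (by gcongr) hqs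
    constructor
    · have e := h (1 / 2 * u) (1 / 2 * u)
      have h₁ := (hr _ (hscale (1 / 2) (by rw [abs_of_pos (by norm_num)]; exact hq2))).1
      have h₂ := (hr _ (hscale _ (hhalf k hkm))).2
      have h₃ := (hr _ (hscale _ (hhalf l hlm))).2
      rw [show m * (k / (2 * m) * u) = k * (1 / 2 * u) by field_simp] at h₂
      rw [show m * (l / (2 * m) * u) = l * (1 / 2 * u) by field_simp] at h₃
      rw [show 1 / 2 * u + 1 / 2 * u = u by ring] at e
      exact left_ne_zero_of_mul (e ▸ mul_ne_zero (mul_ne_zero h₁ h₂) (mul_ne_zero h₁ h₃))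
    · have e := h (|k| / k * m / (|k| + |l|) * u) (|l| / l * m / (|k| + |l|) * u)
      have habs (c : ℝ) (hc : c ≠ 0) : |(|c| / c * m)| ≤ m := by
        rw [abs_mul, abs_div, abs_abs, div_self (abs_ne_zero.2 hc), one_mul, abs_of_pos hm]
      have h₁ := (hr _ (hscale _ (hpart _ (habs k hk)))).1
      have h₂ := (hr _ (hscale _ (hpart _ (habs l hl)))).1
      have h₃ := (hr _ (hscale _ (hpart |k| (by rwa [abs_abs])))).2
      have h₄ := (hr _ (hscale _ (hpart |l| (by rwa [abs_abs])))).2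
      rw [show m * (|k| / (|k| + |l|) * u) = k * (|k| / k * m / (|k| + |l|) * u) by
        field_simp] at h₃
      rw [show m * (|l| / (|k| + |l|) * u) = l * (|l| / l * m / (|k| + |l|) * u) by
        field_simp] at h₄
      rw [show k * (|k| / k * m / (|k| + |l|) * u) + l * (|l| / l * m / (|k| + |l|) * u) = m * u by
        field_simp] at e
      exact right_ne_zero_of_mul (e ▸ mul_ne_zero (mul_ne_zero h₁ h₃) (mul_ne_zero h₂ h₄))
  have iter (n : ℕ) (r : ℝ) (hr : ∀ u, |u| ≤ q ^ n * r → f u ≠ 0 ∧ g (m * u) ≠ 0) :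
      ∀ u, |u| ≤ r → f u ≠ 0 ∧ g (m * u) ≠ 0 := by
    induction n generalizing r with
    | zero => simpa using hr
    | succ n ih => exact step r (ih (q * r) (by simpa [pow_succ, mul_assoc] using hr))
  obtain ⟨ε, hε, hnear⟩ : ∃ ε > 0, ∀ u, |u| < ε → f u ≠ 0 ∧ g (m * u) ≠ 0 := by
    have h₁ : ∀ᶠ u in nhds (0 : ℝ), f u ≠ 0 := hf.continuousAt.eventually_ne hf0
    have h₂ : ∀ᶠ u in nhds (0 : ℝ), g (m * u) ≠ 0 :=
      (by fun_prop : Continuous fun u ↦ g (m * u)).continuousAt.eventually_ne (by simpa using hg0)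
    simpa [Metric.eventually_nhds_iff] using h₁.and h₂
  have all (u : ℝ) : f u ≠ 0 ∧ g (m * u) ≠ 0 := by
    have hlim := (tendsto_pow_atTop_nhds_zero_of_lt_one hq0 hq1).mul_const |u|
    rw [zero_mul] at hlim
    obtain ⟨n, hn⟩ := (hlim.eventually_lt_const hε).exists
    exact iter n |u| (fun v hv ↦ hnear v (hv.trans_lt hn)) u le_rfl
  refine ⟨fun x ↦ (all x).1, fun x ↦ ?_⟩
  have := (all (x / m)).2
  rwa [mul_div_cancel₀ x hm.ne'] at this

/-- In the Darmois–Skitovich functional equation with distinct coefficients, the first function has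
trivial multiplicative third differences at the origin. -/
lemma third_difference_of_darmois_skitovich {f g : ℝ → ℂ} (hg0 : g 0 = 1)
    (hg : ∀ x, g x ≠ 0) {k l : ℝ} (hkl : k ≠ l)
    (h : ∀ x y, f (x + y) * g (k * x + l * y) = f x * g (k * x) * (f y * g (l * y)))
    (x y z : ℝ) : f (x + y + z) * f x * f y * f z = f (x + y) * f (y + z) * f (x + z) := by
  obtain ⟨t, rfl⟩ : ∃ t, z = (l - k) * t :=
    ⟨z / (l - k), by field_simp [sub_ne_zero.2 hkl.symm]⟩
  have e (u v : ℝ) : f (u + v + (l - k) * t) * g (k * u + l * v) =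
      f (u + l * t) * g (k * (u + l * t)) * (f (v - k * t) * g (l * (v - k * t))) := by
    rw [← h]
    ring_nf
  have e₀ := h x y
  have e₁ := e x y
  have e₂ := e x 0
  have e₃ := e 0 y
  have e₄ := e 0 0
  simp only [mul_zero, add_zero, zero_add, hg0, mul_one] at e₂ e₃ e₄
  have hc : g (k * x + l * y) * (g (k * x) * g (l * y)) ≠ 0 :=
    mul_ne_zero (hg _) (mul_ne_zero (hg _) (hg _))
  have e₅ : f (x + y + (l - k) * t) * g (k * x + l * y) * f ((l - k) * t) =
      (f (x + (l - k) * t) * g (k * x)) * (f (y + (l - k) * t) * g (l * y)) := by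
    rw [e₁, e₂, e₃, e₄]
    ring
  refine mul_right_cancel₀ hc ?_
  linear_combination (f x * f y * g (k * x) * g (l * y)) * e₅
    - f (x + (l - k) * t) * g (k * x) * f (y + (l - k) * t) * g (l * y) * e₀

lemma ProbabilityTheory.IndepFun.charFun_map_linear_combination {Ω : Type*} [MeasurableSpace Ω]
    {μ : Measure Ω} [IsProbabilityMeasure μ] {X Y : Ω → ℝ} (hX : Measurable X) (hY : Measurable Y)
    (hXY : IndepFun X Y μ) (s t u : ℝ) :
    charFun (μ.map fun ω ↦ s * X ω + t * Y ω) u =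
      charFun (μ.map X) (s * u) * charFun (μ.map Y) (t * u) := by
  have hi : IndepFun (fun ω ↦ s * X ω) (fun ω ↦ t * Y ω) μ :=
    hXY.comp (measurable_const_mul s) (measurable_const_mul t)
  rw [hi.charFun_map_fun_add_eq_mul (by fun_prop) (by fun_prop), Pi.mul_apply,
    charFun_map_mul_comp hX.aemeasurable, charFun_map_mul_comp hY.aemeasurable]

/-- Two probability measures whose characteristic functions solve the Darmois–Skitovich functional
equation are Gaussian. -/
lemma exists_eq_gaussianReal_of_charFun_darmois_skitovich {ν ρ : Measure ℝ}
    [IsProbabilityMeasure ν] [IsProbabilityMeasure ρ] {k l : ℝ} (hk : k ≠ 0) (hl : l ≠ 0)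
    (h : ∀ x y, charFun ν (x + y) * charFun ρ (k * x + l * y) =
      charFun ν x * charFun ρ (k * x) * (charFun ν y * charFun ρ (l * y))) :
    (∃ (m : ℝ) (v : ℝ≥0), ν = gaussianReal m v) ∧
      ∃ (m : ℝ) (v : ℝ≥0), ρ = gaussianReal m v := by
  obtain rfl | hkl := eq_or_ne k l
  · have hone (x : ℝ) : ‖charFun ν x‖ = 1 ∧ ‖charFun ρ (k * x)‖ = 1 := by
      have e := congrArg norm (h x (-x))
      simp only [add_neg_cancel, mul_neg, charFun_neg, charFun_zero, probReal_univ, norm_mul,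
        RCLike.norm_conj, Complex.ofReal_one, norm_one, mul_one] at e
      have h₁ := norm_charFun_le_one (μ := ν) x
      have h₂ := norm_charFun_le_one (μ := ρ) (k * x)
      have h₃ := norm_nonneg (charFun ν x)
      have h₄ := norm_nonneg (charFun ρ (k * x))
      have hp : ‖charFun ν x‖ * ‖charFun ρ (k * x)‖ = 1 := by nlinarith [mul_nonneg h₃ h₄]
      constructor <;> nlinarith
    refine ⟨exists_eq_gaussianReal_of_norm_charFun_eq_one fun x ↦ (hone x).1,
      exists_eq_gaussianReal_of_norm_charFun_eq_one fun x ↦ ?_⟩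
    have := (hone (x / k)).2
    rwa [mul_div_cancel₀ x hk] at this
  · obtain ⟨hν, hρ⟩ := ne_zero_of_darmois_skitovich continuous_charFun continuous_charFun
      (by simp) (by simp) hk hl h
    have h' (x y : ℝ) : charFun ρ (x + y) * charFun ν (k⁻¹ * x + l⁻¹ * y) =
        charFun ρ x * charFun ν (k⁻¹ * x) * (charFun ρ y * charFun ν (l⁻¹ * y)) := by
      have e := h (k⁻¹ * x) (l⁻¹ * y)
      rw [mul_inv_cancel_left₀ hk, mul_inv_cancel_left₀ hl] at e
      linear_combination e
    exact ⟨exists_eq_gaussianReal_of_charFun hν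
        (third_difference_of_darmois_skitovich (by simp) hρ hkl h),
      exists_eq_gaussianReal_of_charFun hρ
        (third_difference_of_darmois_skitovich (by simp) hν (inv_injective.ne hkl) h')⟩

theorem darmois_skitovich {Ω : Type*} [MeasurableSpace Ω]
    (μ : Measure Ω) [IsProbabilityMeasure μ]
    (X E : Ω → ℝ) (hX : Measurable X) (hE : Measurable E)
    (hindep : IndepFun X E μ)
    (a b c d : ℝ) (hac : a * c ≠ 0) (hbd : b * d ≠ 0)
    (L₁ L₂ : Ω → ℝ)
    (hL₁ : ∀ ω, L₁ ω = a * X ω + b * E ω)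
    (hL₂ : ∀ ω, L₂ ω = c * X ω + d * E ω)
    (hLindep : IndepFun L₁ L₂ μ) :
    (∃ (m : ℝ) (v : ℝ≥0), Measure.map X μ = gaussianReal m v) ∧
    (∃ (m : ℝ) (v : ℝ≥0), Measure.map E μ = gaussianReal m v) := by
  obtain ⟨ha, hc⟩ := mul_ne_zero_iff.1 hac
  obtain ⟨hb, hd⟩ := mul_ne_zero_iff.1 hbd
  obtain rfl : L₁ = fun ω ↦ a * X ω + b * E ω := funext hL₁
  obtain rfl : L₂ = fun ω ↦ c * X ω + d * E ω := funext hL₂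
  have := Measure.isProbabilityMeasure_map (μ := μ) hX.aemeasurable
  have := Measure.isProbabilityMeasure_map (μ := μ) hE.aemeasurable
  refine exists_eq_gaussianReal_of_charFun_darmois_skitovich (div_ne_zero hb ha)
    (div_ne_zero hd hc) fun x y ↦ ?_
  have e := hLindep.charFun_map_linear_combination (by fun_prop) (by fun_prop) (x / a) (y / c) 1
  have e' := hindep.charFun_map_linear_combination hX hE (x + y) (b / a * x + d / c * y) 1
  have hcomb : (fun ω ↦ x / a * (a * X ω + b * E ω) + y / c * (c * X ω + d * E ω)) =
      fun ω ↦ (x + y) * X ω + (b / a * x + d / c * y) * E ω := by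
    funext ω
    field_simp
    ring
  rw [hcomb, e', hindep.charFun_map_linear_combination hX hE,
    hindep.charFun_map_linear_combination hX hE] at e
  convert e using 3 <;> field_simp
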